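/- arXiv:2406.06815 — 2 statements merged into one kernel-verified Lean document; each statement's English description precedes it below -/
import Mathlib

section
/- For every ε > 0 there exist M₀, k₀ ∈ ℕ such that the following holds. Let M ≥ M₀ and δ ∈ (0, 1/2] be such that M^δ ∈ ℕ, and let A = {0, 1, …, M^δ − 1}. Suppose α ∈ ℚ with 1 ≤ α < M and k ≥ k₀ are such that N = α·M^k is a positive integer divisible by M. Let b/q ∈ ℚ be an irreducible fraction with 0 < q ≤ M^δ and |α/M − b/q| < 1/(q·M^δ). Then ‖𝟙_{C_k(N)} F_N 𝟙_{C_k(N)}‖ ≤ N^{−(1/2 − δ + γ/2) + ε}, where γ = log q / log M. -/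
open scoped Classical

noncomputable section

/-- `e^{-2πi x}` -/
def ec (x : ℝ) : ℂ := Complex.exp (-(2 * Real.pi * x) * Complex.I)

/-- The discrete Fourier transform matrix `F_N`, with entries `N^{-1/2} e^{-2πi jl/N}`. -/
def dftMatrix (N : ℕ) : Matrix (Fin N) (Fin N) ℂ :=
  Matrix.of fun j l : Fin N => ((Real.sqrt N)⁻¹ : ℝ) * ec ((j : ℕ) * (l : ℕ) / (N : ℝ))

/-- Multiplication by the indicator function of `S`, as a matrix on `ℂ^N`. -/
def indicatorMatrix (N : ℕ) (S : Finset ℕ) : Matrix (Fin N) (Fin N) ℂ :=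
  Matrix.diagonal fun j => if (j : ℕ) ∈ S then 1 else 0

/-- The discrete Cantor set `C_k = {a₀ + a₁ M + ⋯ + a_{k-1} M^{k-1} : a_j ∈ A}`. -/
def cantorC (M k : ℕ) (A : Finset ℕ) : Finset ℕ :=
  (Fintype.piFinset fun _ : Fin k => A).image fun a => ∑ j : Fin k, a j * M ^ (j : ℕ)

/-- The operator norm of a matrix acting on `ℂ^N` with the ℓ² norm. -/
def opNorm {N : ℕ} (A : Matrix (Fin N) (Fin N) ℂ) : ℝ :=
  ‖Matrix.toEuclideanCLM (𝕜 := ℂ) A‖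

/-- The dilated discrete Cantor set `C_k(N) = { ⌈α j⌉ : j ∈ C_k }`. -/
def cantorCdil (M k : ℕ) (A : Finset ℕ) (α : ℚ) : Finset ℕ :=
  (cantorC M k A).image fun j => (⌈α * (j : ℚ)⌉).toNat

def nd (x : ℝ) : ℝ := |x - round x|

lemma nd_nonneg (x : ℝ) : 0 ≤ nd x := abs_nonneg _

lemma nd_le (x : ℝ) (z : ℤ) : nd x ≤ |x - z| := round_le x z

lemma nd_add_le (x y : ℝ) : nd (x + y) ≤ nd x + |y| := by
  refine (nd_le (x + y) (round x)).trans ?_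
  have : x + y - round x = (x - round x) + y := by ring
  rw [this]
  exact abs_add_le _ _

lemma nd_add_int (x : ℝ) (z : ℤ) : nd (x + z) = nd x := by
  unfold nd
  rw [round_add_intCast]
  push_cast
  congr 1
  ring

lemma ec_add (x y : ℝ) : ec (x + y) = ec x * ec y := by
  unfold ec
  rw [← Complex.exp_add]
  congr 1
  push_cast
  ring

lemma ec_int (z : ℤ) : ec z = 1 := by
  unfold ec
  rw [Complex.exp_eq_one_iff]
  exact ⟨-z, by push_cast; ring⟩

lemma ec_zero : ec 0 = 1 := by simpa using ec_int 0

lemma norm_ec (x : ℝ) : ‖ec x‖ = 1 := by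
  unfold ec
  have : (-(2 * Real.pi * x) * Complex.I : ℂ) = ((-(2 * Real.pi * x) : ℝ) : ℂ) * Complex.I := by
    push_cast; ring
  rw [this, Complex.norm_exp_ofReal_mul_I]

lemma conj_ec (x : ℝ) : (starRingEnd ℂ) (ec x) = ec (-x) := by
  unfold ec
  rw [← Complex.exp_conj]
  congr 1
  have : (starRingEnd ℂ) 2 = 2 := Complex.conj_ofNat 2
  simp [this]

lemma ec_nat_mul (n : ℕ) (x : ℝ) : ec (n * x) = ec x ^ n := by
  unfold ec
  rw [← Complex.exp_nat_mul]
  congr 1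
  push_cast
  ring

lemma ec_sum {ι : Type*} (s : Finset ι) (f : ι → ℝ) : ec (∑ i ∈ s, f i) = ∏ i ∈ s, ec (f i) := by
  induction s using Finset.induction_on with
  | empty => simp [ec_zero]
  | insert a s ha ih => rw [Finset.sum_insert ha, Finset.prod_insert ha, ec_add, ih]

lemma norm_ec_sub_one (x : ℝ) : 4 * nd x ≤ ‖ec x - 1‖ := by
  have h1 : ec x = ec (x - round x) := by
    have : x = (x - round x) + (round x : ℤ) := by ring
    conv_lhs => rw [this, ec_add, ec_int, mul_one]
  rw [h1]
  unfold nd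
  set y := x - round x with hy
  have hy2 : |y| ≤ 1 / 2 := abs_sub_round x
  have h2 : ec y = Complex.exp (Complex.I * ((-(2 * Real.pi * y) : ℝ) : ℂ)) := by
    unfold ec; congr 1; push_cast; ring
  rw [h2, Complex.norm_exp_I_mul_ofReal_sub_one]
  have hpi := Real.pi_pos
  have h3 : -(2 * Real.pi * y) / 2 = -(Real.pi * y) := by ring
  rw [h3, Real.sin_neg, Real.norm_eq_abs, abs_mul, abs_neg]
  have h4 := Real.mul_abs_le_abs_sin (x := Real.pi * y) (by
    rw [abs_mul, abs_of_pos hpi]; nlinarith)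
  rw [abs_mul Real.pi, abs_of_pos hpi] at h4
  have h5 : 2 / Real.pi * (Real.pi * |y|) = 2 * |y| := by field_simp
  rw [h5] at h4
  rw [abs_of_pos (by norm_num : (0:ℝ) < 2)]
  linarith

/-- the geometric sum -/
def gs (D : ℕ) (x : ℝ) : ℂ := ∑ c : Fin D, ec (x * (c : ℕ))

lemma gs_eq (D : ℕ) (x : ℝ) : gs D x = ∑ c ∈ Finset.range D, ec x ^ c := by
  unfold gs
  rw [Finset.sum_range]
  refine Finset.sum_congr rfl fun c _ => ?_
  rw [mul_comm, ec_nat_mul]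

lemma norm_gs_le (D : ℕ) (x : ℝ) : ‖gs D x‖ ≤ D := by
  unfold gs
  refine (norm_sum_le _ _).trans ?_
  simp [norm_ec]

lemma norm_gs_mul (D : ℕ) (x : ℝ) : ‖gs D x‖ * nd x ≤ 1 / 2 := by
  have h1 := geom_sum_mul (ec x) D
  rw [← gs_eq] at h1
  have h2 : ‖gs D x‖ * ‖ec x - 1‖ ≤ 2 := by
    rw [← norm_mul, h1]
    refine (norm_sub_le _ _).trans ?_
    rw [norm_pow, norm_ec]; norm_num
  have h3 := norm_ec_sub_one x
  have h4 := norm_nonneg (gs D x)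
  nlinarith

lemma norm_gs_le_h (D : ℕ) (hD : 0 < D) (x s : ℝ) (hs : |s| ≤ 1 / D) :
    ‖gs D (x - s)‖ ≤ 3 * D * (1 / (1 + D * nd x)) := by
  have hD' : (0:ℝ) < D := by exact_mod_cast hD
  have hn := nd_nonneg x
  have hp : 0 < 1 + D * nd x := by positivity
  rw [mul_one_div, le_div_iff₀ hp]
  have h1 := norm_gs_le D (x - s)
  have h2 := norm_gs_mul D (x - s)
  have h3 := nd_add_le (x - s) s
  rw [sub_add_cancel] at h3
  have h4 := norm_nonneg (gs D (x - s))
  have h5 : D * |s| ≤ 1 := by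
    calc D * |s| ≤ D * (1 / D) := by gcongr
      _ = 1 := by field_simp
  set g := ‖gs D (x - s)‖
  have h6 : g * (D * nd x) ≤ D * (g * nd (x - s)) + g * (D * |s|) := by
    have := mul_le_mul_of_nonneg_left h3 (mul_nonneg h4 hD'.le)
    nlinarith
  have h7 : g * (D * |s|) ≤ g := by nlinarith
  nlinarith
lemma block0 (q : ℕ) (hq : 0 < q) (θ : ℝ) (h0 : 0 ≤ θ) (h1 : θ < 1) :
    ∑ r ∈ Finset.range q, 1 / (1 + q * nd ((r + θ) / q)) ≤ 2 * (1 + Real.log q) := by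
  have hq' : (0:ℝ) < q := by exact_mod_cast hq
  have key : ∀ r ∈ Finset.range q, 1 / (1 + q * nd ((r + θ) / q)) ≤
      1 / ((r:ℝ) + 1) + 1 / (((q - 1 - r : ℕ) : ℝ) + 1) := by
    intro r hr
    have hr' : r + 1 ≤ q := Finset.mem_range.1 hr
    have hc : ((q - 1 - r : ℕ) : ℝ) = q - 1 - r := by
      rw [Nat.cast_sub (by omega), Nat.cast_sub (by omega)]; simp
    have hcn : (0:ℝ) ≤ (q:ℝ) - 1 - r := by rw [← hc]; positivity
    rw [hc]
    set x := ((r:ℝ) + θ) / q with hx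
    have hqx : q * x = r + θ := by rw [hx]; field_simp
    have hz : q * nd x = |q * x - q * round x| := by
      unfold nd
      rw [← mul_sub, abs_mul, abs_of_pos hq']
    rw [hz, hqx]
    rcases le_or_gt (round x) 0 with h | h
    · have hh : ((round x : ℤ) : ℝ) ≤ 0 := by exact_mod_cast h
      have : (r:ℝ) ≤ |r + θ - q * round x| := by
        refine le_trans ?_ (le_abs_self _)
        nlinarith
      have a1 : 1 / (1 + |r + θ - q * round x|) ≤ 1 / ((r:ℝ) + 1) :=
        one_div_le_one_div_of_le (by positivity) (by linarith)
      have a2 : 0 ≤ 1 / ((q:ℝ) - 1 - r + 1) := by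
        apply one_div_nonneg.2; linarith
      linarith
    · have hh : (1:ℝ) ≤ ((round x : ℤ) : ℝ) := by exact_mod_cast h
      have : (q:ℝ) - 1 - r ≤ |r + θ - q * round x| := by
        refine le_trans ?_ (neg_le_abs _)
        nlinarith
      have a1 : 1 / (1 + |r + θ - q * round x|) ≤ 1 / ((q:ℝ) - 1 - r + 1) :=
        one_div_le_one_div_of_le (by linarith) (by linarith)
      have a2 : 0 ≤ 1 / ((r:ℝ) + 1) := by positivity
      linarith
  refine (Finset.sum_le_sum key).trans ?_
  rw [Finset.sum_add_distrib, Finset.sum_range_reflect (fun r => 1 / ((r:ℝ) + 1)) q]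
  have := harmonic_le_one_add_log q
  have h2 : ((harmonic q : ℚ) : ℝ) = ∑ r ∈ Finset.range q, 1 / ((r:ℝ) + 1) := by
    unfold harmonic
    push_cast
    simp
  rw [h2] at this
  linarith

/-- function periodic mod q, sums over a complete residue system -/
lemma sum_periodic (q : ℕ) (hq : 0 < q) (f : ℤ → ℝ) (hf : ∀ n m : ℤ, f (n + q * m) = f n)
    (b c : ℤ) (hb : Int.gcd b q = 1) :
    ∑ r ∈ Finset.range q, f (b * r + c) = ∑ r ∈ Finset.range q, f r := by
  have hmod : ∀ n : ℤ, f n = f (n % q) := by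
    intro n
    conv_lhs => rw [← Int.emod_add_mul_ediv n q, hf]
  have hqz : (0:ℤ) < q := by exact_mod_cast hq
  set e : ℕ → ℕ := fun r => ((b * r + c) % q).toNat with he
  have hcast : ∀ r, ((e r : ℕ) : ℤ) = (b * r + c) % q := by
    intro r
    exact Int.toNat_of_nonneg (Int.emod_nonneg (b * r + c) hqz.ne')
  have hinj : Set.InjOn e (Finset.range q : Set ℕ) := by
    intro r hr s hs h
    have hr' := Finset.mem_range.1 (Finset.mem_coe.1 hr)
    have hs' := Finset.mem_range.1 (Finset.mem_coe.1 hs)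
    have h1 : (b * r + c) % q = (b * s + c) % q := by rw [← hcast, ← hcast, h]
    have h2 : (q:ℤ) ∣ b * (s - r) := by
      have h3 := Int.ModEq.dvd h1
      have h4 : b * s + c - (b * r + c) = b * ((s:ℤ) - r) := by ring
      rwa [h4] at h3
    have h5 : (q:ℤ) ∣ (s:ℤ) - r := by
      refine Int.dvd_of_dvd_mul_right_of_gcd_one h2 ?_
      rw [Int.gcd_comm]; exact hb
    have h6 : ((s:ℤ) - r) = 0 := by
      apply Int.eq_zero_of_abs_lt_dvd h5
      rw [abs_lt]; constructor <;> omega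
    omega
  have himg : (Finset.range q).image e = Finset.range q := by
    apply Finset.eq_of_subset_of_card_le
    · intro x hx
      obtain ⟨r, _, rfl⟩ := Finset.mem_image.1 hx
      have h1 := Int.emod_lt_of_pos (b * r + c) hqz
      rw [← hcast] at h1
      exact Finset.mem_range.2 (by exact_mod_cast h1)
    · rw [Finset.card_image_of_injOn hinj]
  conv_rhs => rw [← himg]
  rw [Finset.sum_image hinj]
  refine Finset.sum_congr rfl fun r _ => ?_
  rw [hmod, hcast]

lemma block1 (q : ℕ) (hq : 0 < q) (b : ℤ) (hb : Int.gcd b q = 1) (t : ℝ) :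
    ∑ r ∈ Finset.range q, 1 / (1 + q * nd (t - b / q * r)) ≤ 2 * (1 + Real.log q) := by
  have hq' : (0:ℝ) < q := by exact_mod_cast hq
  refine le_trans (le_of_eq ?_) (block0 q hq (Int.fract (t * q)) (Int.fract_nonneg _)
    (Int.fract_lt_one _))
  have := sum_periodic q hq (fun n : ℤ => 1 / (1 + q * nd ((n + Int.fract (t * q)) / q))) (by
    intro n m
    have : (((n + q * m : ℤ) : ℝ) + Int.fract (t * q)) / q = (n + Int.fract (t * q)) / q + m := by
      push_cast; field_simp; ring
    simp only [this, nd_add_int]) (-b) ⌊t * q⌋ (by rwa [Int.neg_gcd])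
  simp only [Int.cast_natCast] at this
  rw [← this]
  refine Finset.sum_congr rfl fun r _ => ?_
  have h2 : t - b / q * r = ((((-b) * r + ⌊t * q⌋ : ℤ) : ℝ) + Int.fract (t * q)) / q := by
    have := Int.floor_add_fract (t * q)
    rw [eq_div_iff hq'.ne']
    push_cast
    field_simp
    linarith
  rw [h2]

lemma block2 (q D : ℕ) (hq : 0 < q) (hqD : q ≤ D) (b : ℤ) (hb : Int.gcd b q = 1) (β t : ℝ)
    (hβ : |β - b / q| ≤ 1 / (q * D)) :
    ∑ r ∈ Finset.range q, 1 / (1 + D * nd (t - β * r)) ≤ 4 * (1 + Real.log q) := by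
  have hq' : (0:ℝ) < q := by exact_mod_cast hq
  have hqD' : (q:ℝ) ≤ D := by exact_mod_cast hqD
  have hD' : (0:ℝ) < D := by linarith
  have key : ∀ r ∈ Finset.range q, 1 / (1 + D * nd (t - β * r)) ≤
      2 * (1 / (1 + q * nd (t - b / q * r))) := by
    intro r hr
    have hr' : (r:ℝ) ≤ q := by exact_mod_cast (Finset.mem_range.1 hr).le
    have h1 := nd_add_le (t - β * r) ((β - b / q) * r)
    have h2 : t - β * r + (β - b / q) * r = t - b / q * r := by ring
    rw [h2, abs_mul, Nat.abs_cast] at h1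
    have h3 : |β - b / q| * r ≤ 1 / (q * D) * q := by gcongr
    have h4 : q * (1 / (q * D) * q) ≤ (1:ℝ) := by
      have : (q:ℝ) * (1 / (q * D) * q) = q / D := by field_simp
      rw [this]
      exact (div_le_one hD').2 hqD'
    have n1 := nd_nonneg (t - β * r)
    have n2 := nd_nonneg (t - b / q * r)
    rw [mul_one_div, div_le_div_iff₀ (by positivity) (by positivity)]
    have h5 : q * nd (t - b / q * r) ≤ q * nd (t - β * r) + 1 := by
      have := mul_le_mul_of_nonneg_left (h1.trans (add_le_add_right h3 _)) hq'.le
      linarith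
    have h6 : q * nd (t - β * r) ≤ D * nd (t - β * r) := by gcongr
    have h7 : 0 ≤ D * nd (t - β * r) := by positivity
    linarith
  refine (Finset.sum_le_sum key).trans ?_
  rw [← Finset.mul_sum]
  have := block1 q hq b hb t
  linarith

lemma block3 (q D : ℕ) (hq : 0 < q) (hqD : q ≤ D) (b : ℤ) (hb : Int.gcd b q = 1) (β t : ℝ)
    (hβ : |β - b / q| ≤ 1 / (q * D)) :
    ∑ a ∈ Finset.range D, 1 / (1 + D * nd (t - β * a)) ≤ 8 * (1 + Real.log q) * (D / q) := by
  have hq' : (0:ℝ) < q := by exact_mod_cast hq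
  have hqD' : (q:ℝ) ≤ D := by exact_mod_cast hqD
  have hlog : 0 ≤ Real.log q := Real.log_natCast_nonneg q
  have hb : ∀ n : ℕ, ∑ a ∈ Finset.range (q * n), 1 / (1 + D * nd (t - β * a)) ≤
      n * (4 * (1 + Real.log q)) := by
    intro n
    induction n with
    | zero => simp
    | succ n ih =>
      rw [Nat.mul_succ, Finset.sum_range_add]
      have h2 := block2 q D hq hqD b hb β (t - β * (q * n)) hβ
      have h3 : ∀ r : ℕ, t - β * ((q * n + r : ℕ) : ℝ) = t - β * (q * n) - β * r := by
        intro r; push_cast; ring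
      simp only [h3]
      push_cast
      linarith
  have h1 : D ≤ q * (D / q + 1) := by
    have := Nat.lt_mul_div_succ D hq
    exact this.le
  refine (Finset.sum_le_sum_of_subset_of_nonneg (Finset.range_mono h1) ?_).trans
    ((hb _).trans ?_)
  · intro i _ _
    have := nd_nonneg (t - β * i)
    positivity
  · have h2 : ((D / q + 1 : ℕ) : ℝ) ≤ 2 * (D / q) := by
      have h3 : ((D / q : ℕ) : ℝ) ≤ D / q := Nat.cast_div_le
      have h4 : (1:ℝ) ≤ D / q := (one_le_div hq').2 hqD'
      push_cast
      linarith
    calc _ ≤ (2 * (D / q)) * (4 * (1 + Real.log q)) := by gcongr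
      _ = _ := by ring
def VV (M D k : ℕ) (a : Fin k → Fin D) : ℝ := ∑ i : Fin k, ((a i : ℕ) : ℝ) / (M:ℝ) ^ (i : ℕ)

lemma VV_cons (M D k : ℕ) (a0 : Fin D) (a : Fin k → Fin D) :
    VV M D (k + 1) (Fin.cons a0 a) = (a0 : ℕ) + VV M D k a / M := by
  unfold VV
  rw [Fin.sum_univ_succ, Finset.sum_div]
  simp [pow_succ, div_div]

lemma VV_nonneg (M D k : ℕ) (a : Fin k → Fin D) : 0 ≤ VV M D k a := by
  unfold VV; positivity

lemma VV_le (M D k : ℕ) (hDM : D ≤ M) (a : Fin k → Fin D) : VV M D k a ≤ D := by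
  induction k with
  | zero => simp [VV]
  | succ k ih =>
    rw [← Fin.cons_self_tail a, VV_cons]
    have h1 : ((a 0 : ℕ) : ℝ) + 1 ≤ D := by exact_mod_cast (a 0).2
    have hM : (0:ℝ) < M := by
      have := (a 0).2
      exact_mod_cast (by omega : 0 < M)
    have h2 : VV M D k (Fin.tail a) / M ≤ 1 := by
      rw [div_le_one hM]
      exact (ih _).trans (by exact_mod_cast hDM)
    linarith

lemma row_sum (M D : ℕ) (hD : 0 < D) (hDM : D * D ≤ M) (β R : ℝ) (hβ0 : 0 ≤ β) (hβ1 : β ≤ 1)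
    (hR : ∀ t : ℝ, ∑ a ∈ Finset.range D, 3 * D * (1 / (1 + D * nd (t - β * a))) ≤ R) (k : ℕ) :
    ∀ t : ℝ, ∑ a : Fin k → Fin D, ∏ p : Fin k, ‖gs D ((M:ℝ) ^ (p : ℕ) * (t - β * VV M D k a))‖
      ≤ R ^ k := by
  have hDM' : D ≤ M := by nlinarith
  have hM : (0:ℝ) < M := by exact_mod_cast (by omega : 0 < M)
  have hD' : (0:ℝ) < D := by exact_mod_cast hD
  have hR0 : 0 ≤ R := by
    refine le_trans ?_ (hR 0)
    refine Finset.sum_nonneg fun i _ => ?_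
    have := nd_nonneg (0 - β * i)
    positivity
  induction k with
  | zero => intro t; simp
  | succ k ih =>
    intro t
    rw [← (Fin.consEquiv (fun _ : Fin (k + 1) => Fin D)).sum_comp, Fintype.sum_prod_type]
    have key : ∀ a0 : Fin D, ∑ a : Fin k → Fin D, ∏ p : Fin (k + 1),
        ‖gs D ((M:ℝ) ^ (p : ℕ) * (t - β * VV M D (k + 1)
          ((Fin.consEquiv (fun _ : Fin (k + 1) => Fin D)) (a0, a))))‖ ≤
        3 * D * (1 / (1 + D * nd (t - β * (a0 : ℕ)))) * R ^ k := by
      intro a0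
      refine le_trans ?_ (mul_le_mul_of_nonneg_left (ih (M * (t - β * (a0 : ℕ)))) ?_)
      · rw [Finset.mul_sum]
        refine Finset.sum_le_sum fun a _ => ?_
        have e1 : (Fin.consEquiv (fun _ : Fin (k + 1) => Fin D)) (a0, a) = Fin.cons a0 a := rfl
        rw [e1, VV_cons, Fin.prod_univ_succ]
        refine mul_le_mul ?_ (le_of_eq ?_) (Finset.prod_nonneg fun _ _ => norm_nonneg _) ?_
        · have e2 : (M:ℝ) ^ ((0 : Fin (k+1)) : ℕ) * (t - β * ((a0 : ℕ) + VV M D k a / M)) =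
              (t - β * (a0 : ℕ)) - β * VV M D k a / M := by
            simp; ring
          rw [e2]
          refine norm_gs_le_h D hD _ _ ?_
          have hv0 := VV_nonneg M D k a
          have hv1 := VV_le M D k hDM' a
          rw [abs_of_nonneg (by positivity), div_le_div_iff₀ hM hD']
          have h3 : β * VV M D k a ≤ 1 * D := by gcongr
          have h4 : (D:ℝ) * D ≤ M := by exact_mod_cast hDM
          nlinarith
        · refine Finset.prod_congr rfl fun p _ => ?_
          congr 2
          rw [Fin.val_succ, pow_succ]
          field_simp
          ring
        · have := nd_nonneg (t - β * (a0 : ℕ))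
          positivity
      · have := nd_nonneg (t - β * (a0 : ℕ))
        positivity
    refine (Finset.sum_le_sum fun a0 _ => key a0).trans ?_
    rw [← Finset.sum_mul, pow_succ']
    refine mul_le_mul_of_nonneg_right ?_ (by positivity)
    refine le_trans (le_of_eq ?_) (hR t)
    rw [Finset.sum_range]
def BL {I J : Type*} [Fintype I] [Fintype J] (B : I → J → ℂ) (K : ℝ) : Prop :=
  ∀ (v : I → ℂ) (u : J → ℂ), ‖∑ a, ∑ c, v a * B a c * u c‖ ≤
    K * (Real.sqrt (∑ a, ‖v a‖ ^ 2) * Real.sqrt (∑ c, ‖u c‖ ^ 2))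

lemma BL_twist {I J : Type*} [Fintype I] [Fintype J] (B : I → J → ℂ) (K : ℝ) (hK : 0 ≤ K)
    (h : BL B K) (f : I → ℝ) (g : J → ℝ) (hf : ∀ a, |f a| ≤ 1) (hg : ∀ c, |g c| ≤ 1) :
    BL (fun a c => B a c * ec (f a * g c)) (Real.exp (2 * Real.pi) * K) := by
  intro v u
  set z : ℂ := -(2 * Real.pi) * Complex.I with hz
  have hzn : ‖z‖ = 2 * Real.pi := by
    rw [hz]; simp [abs_of_pos Real.pi_pos]
  have hs : ∀ x y : ℝ, HasSum (fun n : ℕ => ((n.factorial : ℂ))⁻¹ * z ^ n * (x ^ n * y ^ n))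
      (ec (x * y)) := by
    intro x y
    have h1 := NormedSpace.exp_series_hasSum_exp' (𝕂 := ℂ) (z * (x * y) : ℂ)
    rw [← Complex.exp_eq_exp_ℂ] at h1
    have e1 : (fun n : ℕ => ((n.factorial : ℂ))⁻¹ * z ^ n * ((x:ℂ) ^ n * (y:ℂ) ^ n)) =
        fun n : ℕ => ((n.factorial : ℂ))⁻¹ • (z * (x * y) : ℂ) ^ n := by
      funext n
      rw [smul_eq_mul, mul_pow z, mul_pow (x:ℂ), mul_assoc]
    have e2 : ec (x * y) = Complex.exp (z * (x * y)) := by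
      unfold ec; congr 1; rw [hz]; push_cast; ring
    rw [e1, e2]
    exact h1
  have hs2 : HasSum (fun n : ℕ => ∑ a, ∑ c, v a * (B a c *
      (((n.factorial : ℂ))⁻¹ * z ^ n * ((f a : ℂ) ^ n * (g c : ℂ) ^ n))) * u c)
      (∑ a, ∑ c, v a * (B a c * ec (f a * g c)) * u c) :=
    hasSum_sum fun a _ => hasSum_sum fun c _ =>
      (((hs (f a) (g c)).mul_left (B a c)).mul_left (v a)).mul_right (u c)
  set Q := Real.sqrt (∑ a, ‖v a‖ ^ 2) * Real.sqrt (∑ c, ‖u c‖ ^ 2) with hQ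
  have hQ0 : 0 ≤ Q := by positivity
  have hb : ∀ n : ℕ, ‖∑ a, ∑ c, v a * (B a c *
      (((n.factorial : ℂ))⁻¹ * z ^ n * ((f a : ℂ) ^ n * (g c : ℂ) ^ n))) * u c‖ ≤
      ((n.factorial : ℝ))⁻¹ * (2 * Real.pi) ^ n * (K * Q) := by
    intro n
    have e : ∑ a, ∑ c, v a * (B a c *
      (((n.factorial : ℂ))⁻¹ * z ^ n * ((f a : ℂ) ^ n * (g c : ℂ) ^ n))) * u c =
      (((n.factorial : ℂ))⁻¹ * z ^ n) *
        ∑ a, ∑ c, (v a * (f a : ℂ) ^ n) * B a c * ((g c : ℂ) ^ n * u c) := by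
      simp only [Finset.mul_sum]
      refine Finset.sum_congr rfl fun a _ => Finset.sum_congr rfl fun c _ => ?_
      ring
    rw [e, norm_mul, norm_mul, norm_inv, norm_pow, hzn, Complex.norm_natCast]
    refine mul_le_mul_of_nonneg_left ((h _ _).trans ?_) (by have := Real.pi_pos; positivity)
    refine mul_le_mul_of_nonneg_left ?_ hK
    rw [hQ]
    gcongr with a _ c _
    · rw [norm_mul, norm_pow, Complex.norm_real, Real.norm_eq_abs]
      exact mul_le_of_le_one_right (norm_nonneg _) (pow_le_one₀ (abs_nonneg _) (hf a))
    · rw [norm_mul, norm_pow, Complex.norm_real, Real.norm_eq_abs]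
      exact mul_le_of_le_one_left (norm_nonneg _) (pow_le_one₀ (abs_nonneg _) (hg c))
  have hs3 : HasSum (fun n : ℕ => ((n.factorial : ℝ))⁻¹ * (2 * Real.pi) ^ n * (K * Q))
      (Real.exp (2 * Real.pi) * (K * Q)) := by
    have h1 := NormedSpace.exp_series_hasSum_exp' (𝕂 := ℝ) (2 * Real.pi)
    rw [← Real.exp_eq_exp_ℝ] at h1
    exact h1.mul_right _
  have := tsum_of_norm_bounded hs3 hb
  rw [hs2.tsum_eq] at this
  rw [mul_assoc]
  exact this

lemma BL_schur {I J : Type*} [Fintype I] [Fintype J] (B : I → J → ℂ) (R : ℝ)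
    (h : ∀ a, ∑ a', ‖∑ c, B a c * (starRingEnd ℂ) (B a' c)‖ ≤ R) : BL B (Real.sqrt R) := by
  intro v u
  set w : J → ℂ := fun c => ∑ a, v a * B a c with hw
  have h1 : ∑ a, ∑ c, v a * B a c * u c = ∑ c, w c * u c := by
    rw [Finset.sum_comm]
    simp only [hw, Finset.sum_mul]
  have h2 : ‖∑ c, w c * u c‖ ≤ Real.sqrt (∑ c, ‖w c‖ ^ 2) * Real.sqrt (∑ c, ‖u c‖ ^ 2) := by
    refine (norm_sum_le _ _).trans ?_
    simp only [norm_mul]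
    exact Real.sum_mul_le_sqrt_mul_sqrt _ _ _
  set Kf : I → I → ℂ := fun a a' => ∑ c, B a c * (starRingEnd ℂ) (B a' c) with hKf
  have hsym : ∀ a a', ‖Kf a a'‖ = ‖Kf a' a‖ := by
    intro a a'
    rw [← Complex.norm_conj]
    congr 1
    simp only [hKf, map_sum, map_mul, Complex.conj_conj]
    exact Finset.sum_congr rfl fun c _ => mul_comm _ _
  have h3 : ((∑ c, ‖w c‖ ^ 2 : ℝ) : ℂ) = ∑ a, ∑ a', v a * (starRingEnd ℂ) (v a') * Kf a a' := by
    push_cast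
    have : ∀ c, ((‖w c‖ : ℂ)) ^ 2 = ∑ a, ∑ a', v a * (starRingEnd ℂ) (v a') *
        (B a c * (starRingEnd ℂ) (B a' c)) := by
      intro c
      rw [← Complex.mul_conj', hw]
      simp only [map_sum, map_mul, Finset.sum_mul_sum]
      refine Finset.sum_congr rfl fun a _ => Finset.sum_congr rfl fun c _ => ?_
      ring
    simp only [this, hKf, Finset.mul_sum]
    rw [Finset.sum_comm]
    refine Finset.sum_congr rfl fun a _ => ?_
    rw [Finset.sum_comm]
  have h4 : ∑ c, ‖w c‖ ^ 2 ≤ R * ∑ a, ‖v a‖ ^ 2 := by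
    have h5 : ∑ c, ‖w c‖ ^ 2 = ‖((∑ c, ‖w c‖ ^ 2 : ℝ) : ℂ)‖ := by
      rw [Complex.norm_real, Real.norm_eq_abs, abs_of_nonneg (by positivity)]
    rw [h5, h3]
    have h6 : ‖∑ a, ∑ a', v a * (starRingEnd ℂ) (v a') * Kf a a'‖ ≤
        ∑ a, ∑ a', (‖v a‖ ^ 2 / 2 * ‖Kf a a'‖ + ‖v a'‖ ^ 2 / 2 * ‖Kf a' a‖) := by
      refine (norm_sum_le _ _).trans (Finset.sum_le_sum fun a _ => ?_)
      refine (norm_sum_le _ _).trans (Finset.sum_le_sum fun a' _ => ?_)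
      rw [norm_mul, norm_mul, Complex.norm_conj, hsym a' a]
      have := norm_nonneg (Kf a a')
      nlinarith [mul_nonneg this (sq_nonneg (‖v a‖ - ‖v a'‖))]
    refine h6.trans ?_
    simp only [Finset.sum_add_distrib]
    have h7 : ∑ a, ∑ a', ‖v a'‖ ^ 2 / 2 * ‖Kf a' a‖ = ∑ a, ∑ a', ‖v a‖ ^ 2 / 2 * ‖Kf a a'‖ :=
      Finset.sum_comm
    rw [h7, ← two_mul]
    have h8 : ∑ a, ∑ a', ‖v a‖ ^ 2 / 2 * ‖Kf a a'‖ ≤ ∑ a, ‖v a‖ ^ 2 / 2 * R := by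
      refine Finset.sum_le_sum fun a _ => ?_
      rw [← Finset.mul_sum]
      exact mul_le_mul_of_nonneg_left (h a) (by positivity)
    rw [← Finset.sum_mul, ← Finset.sum_div] at h8
    linarith
  rw [h1]
  refine h2.trans ?_
  rw [← mul_assoc]
  refine mul_le_mul_of_nonneg_right ?_ (Real.sqrt_nonneg _)
  by_cases hR : 0 ≤ R
  · rw [← Real.sqrt_mul hR]
    exact Real.sqrt_le_sqrt h4
  · push Not at hR
    have : R * ∑ a, ‖v a‖ ^ 2 ≤ 0 := mul_nonpos_of_nonpos_of_nonneg hR.le (by positivity)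
    rw [Real.sqrt_eq_zero_of_nonpos (h4.trans this)]
    positivity

/-- transfer a bilinear bound to the operator norm -/
lemma opNorm_le_of_BL {I : Type*} [Fintype I] (N : ℕ) (S : Finset ℕ) (φ : I → Fin N)
    (hφ : Function.Injective φ) (hS : ∀ j : Fin N, (j : ℕ) ∈ S ↔ ∃ a, φ a = j)
    (F : Matrix (Fin N) (Fin N) ℂ) (K : ℝ) (hK : 0 ≤ K) (h : BL (fun a c => F (φ a) (φ c)) K) :
    opNorm (indicatorMatrix N S * F * indicatorMatrix N S) ≤ K := by
  have hsum : ∀ f : Fin N → ℂ, ∑ j : Fin N, (if (j : ℕ) ∈ S then f j else 0) = ∑ a, f (φ a) := by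
    intro f
    rw [← Finset.sum_filter]
    have : Finset.univ.filter (fun j : Fin N => (j : ℕ) ∈ S) = Finset.univ.image φ := by
      ext j; simp [hS]
    rw [this, Finset.sum_image fun a _ b _ hab => hφ hab]
  have hle : ∀ x : EuclideanSpace ℂ (Fin N), Real.sqrt (∑ a, ‖x (φ a)‖ ^ 2) ≤ ‖x‖ := by
    intro x
    rw [EuclideanSpace.norm_eq]
    apply Real.sqrt_le_sqrt
    have : ∑ a, ‖x (φ a)‖ ^ 2 = ∑ j ∈ Finset.univ.image φ, ‖x j‖ ^ 2 := by
      rw [Finset.sum_image fun a _ b _ hab => hφ hab]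
    rw [this]
    exact Finset.sum_le_sum_of_subset_of_nonneg (Finset.subset_univ _) fun _ _ _ => by positivity
  unfold opNorm
  refine ContinuousLinearMap.opNorm_le_bound _ hK fun u => ?_
  set T := indicatorMatrix N S * F * indicatorMatrix N S with hT
  set w := Matrix.toEuclideanCLM (𝕜 := ℂ) T u with hw
  have hTe : ∀ j l, T j l = (if (j : ℕ) ∈ S then 1 else 0) * F j l * (if (l : ℕ) ∈ S then 1 else 0) := by
    intro j l
    rw [hT, indicatorMatrix, Matrix.mul_diagonal, Matrix.diagonal_mul]
  have hwj : ∀ j, w j = ∑ l, T j l * u l := by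
    intro j
    rfl
  have h1 : ((‖w‖ ^ 2 : ℝ) : ℂ) = ∑ a, ∑ c, (starRingEnd ℂ) (w (φ a)) * F (φ a) (φ c) * u (φ c) := by
    rw [EuclideanSpace.norm_sq_eq]
    push_cast
    rw [← hsum fun j => ∑ c, (starRingEnd ℂ) (w j) * F j (φ c) * u (φ c)]
    refine Finset.sum_congr rfl fun j _ => ?_
    rw [← hsum fun l => (starRingEnd ℂ) (w j) * F j l * u l]
    rw [← Complex.conj_mul']
    conv_lhs => rw [hwj j, Finset.mul_sum]
    simp only [hTe]
    split_ifs with hj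
    · refine Finset.sum_congr rfl fun l _ => ?_
      rw [hwj j]
      simp only [hTe]
      split_ifs <;> ring_nf
    · simp
  have h2 := h (fun a => (starRingEnd ℂ) (w (φ a))) (fun c => u (φ c))
  rw [← h1, Complex.norm_real, Real.norm_eq_abs, abs_of_nonneg (by positivity)] at h2
  simp only [Complex.norm_conj] at h2
  have h3 : ‖w‖ ^ 2 ≤ K * (‖w‖ * ‖u‖) := by
    refine h2.trans (mul_le_mul_of_nonneg_left ?_ hK)
    exact mul_le_mul (hle w) (hle u) (Real.sqrt_nonneg _) (norm_nonneg _)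
  rcases (norm_nonneg w).eq_or_lt with h0 | h0
  · rw [← h0]; positivity
  · nlinarith
lemma BL_smul {I J : Type*} [Fintype I] [Fintype J] (B : I → J → ℂ) (K r : ℝ) (hr : 0 ≤ r)
    (h : BL B K) : BL (fun a c => (r : ℂ) * B a c) (r * K) := by
  intro v u
  have : ∑ a, ∑ c, v a * ((r : ℂ) * B a c) * u c = (r : ℂ) * ∑ a, ∑ c, v a * B a c * u c := by
    simp only [Finset.mul_sum]
    refine Finset.sum_congr rfl fun a _ => Finset.sum_congr rfl fun c _ => ?_
    ring
  rw [this, norm_mul, Complex.norm_real, Real.norm_eq_abs, abs_of_nonneg hr, mul_assoc]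
  exact mul_le_mul_of_nonneg_left (h v u) hr

def WW (M D k : ℕ) (a : Fin k → Fin D) : ℕ := ∑ j : Fin k, (a j : ℕ) * M ^ (j : ℕ)

lemma WW_inj (M D k : ℕ) (hDM : D ≤ M) : Function.Injective (WW M D k) := by
  intro a b h
  have h1 : finFunctionFinEquiv (fun i => Fin.castLE hDM (a i)) =
      finFunctionFinEquiv (fun i => Fin.castLE hDM (b i)) := by
    apply Fin.ext
    rw [finFunctionFinEquiv_apply, finFunctionFinEquiv_apply]
    exact h
  have h2 := finFunctionFinEquiv.injective h1
  funext i
  exact Fin.castLE_injective hDM (congrFun h2 i)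

lemma WW_lt (M D k : ℕ) (hDM : D ≤ M) (a : Fin k → Fin D) : WW M D k a < M ^ k := by
  have h1 := (finFunctionFinEquiv (fun i => Fin.castLE hDM (a i))).2
  have h2 := finFunctionFinEquiv_apply (fun i => Fin.castLE hDM (a i))
  rw [h2] at h1
  exact h1

lemma mem_cantorC (M D k : ℕ) (n : ℕ) :
    n ∈ cantorC M k (Finset.range D) ↔ ∃ a, WW M D k a = n := by
  unfold cantorC WW
  simp only [Finset.mem_image, Fintype.mem_piFinset, Finset.mem_range]
  constructor
  · rintro ⟨a, ha, rfl⟩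
    exact ⟨fun i => ⟨a i, ha i⟩, rfl⟩
  · rintro ⟨a, rfl⟩
    exact ⟨fun i => a i, fun i => (a i).2, rfl⟩

lemma sum_ec (M D k : ℕ) (x : ℝ) :
    ∑ c : Fin k → Fin D, ec (x * WW M D k c) = ∏ p : Fin k, gs D ((M:ℝ) ^ (p : ℕ) * x) := by
  unfold gs
  rw [Finset.prod_univ_sum, Fintype.piFinset_univ]
  refine Finset.sum_congr rfl fun c _ => ?_
  rw [← ec_sum]
  congr 1
  unfold WW
  push_cast
  rw [Finset.mul_sum]
  refine Finset.sum_congr rfl fun i _ => ?_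
  ring

lemma WW_rev (M D k : ℕ) (hM : 0 < M) (α : ℝ) (a : Fin k → Fin D) :
    α * WW M D k (a ∘ Fin.rev) / (M:ℝ) ^ k = α / M * VV M D k a := by
  have hM' : (M:ℝ) ≠ 0 := by exact_mod_cast hM.ne'
  unfold WW VV
  push_cast
  rw [← Equiv.sum_comp Fin.revPerm, Finset.mul_sum, Finset.mul_sum, Finset.sum_div]
  refine Finset.sum_congr rfl fun i _ => ?_
  simp only [Fin.revPerm_apply, Function.comp, Fin.rev_rev, Fin.val_rev]
  have : (M:ℝ) ^ k = M ^ (k - (i + 1)) * M ^ (i : ℕ) * M := by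
    rw [← pow_add, ← pow_succ]
    congr 1
    have := i.2
    omega
  rw [this]
  field_simp

lemma core_BL (M D k q : ℕ) (α : ℝ) (b : ℤ) (hD : 0 < D) (hDM : D * D ≤ M) (hα0 : 0 ≤ α)
    (hα1 : α ≤ M) (hq : 0 < q) (hqD : q ≤ D) (hb : Int.gcd b q = 1)
    (hβ : |α / M - b / q| ≤ 1 / (q * D)) :
    BL (fun a c : Fin k → Fin D => ec (α * WW M D k a / (M:ℝ) ^ k * WW M D k c))
      (Real.sqrt ((24 * (1 + Real.log q) * (D ^ 2 / q)) ^ k)) := by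
  have hM : 0 < M := by nlinarith
  have hM' : (0:ℝ) < M := by exact_mod_cast hM
  apply BL_schur
  intro a
  have h1 : ∀ a' : Fin k → Fin D, ∑ c, ec (α * WW M D k a / (M:ℝ) ^ k * WW M D k c) *
      (starRingEnd ℂ) (ec (α * WW M D k a' / (M:ℝ) ^ k * WW M D k c)) =
      ∏ p : Fin k, gs D ((M:ℝ) ^ (p : ℕ) *
        (α * WW M D k a / (M:ℝ) ^ k - α * WW M D k a' / (M:ℝ) ^ k)) := by
    intro a'
    rw [← sum_ec]
    refine Finset.sum_congr rfl fun c _ => ?_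
    rw [conj_ec, ← ec_add]
    congr 1
    ring
  simp only [h1, norm_prod]
  rw [← Equiv.sum_comp (Equiv.arrowCongr (Fin.revPerm (n := k)) (Equiv.refl (Fin D)))]
  have h2 : ∀ a' : Fin k → Fin D,
      (Equiv.arrowCongr (Fin.revPerm (n := k)) (Equiv.refl (Fin D))) a' = a' ∘ Fin.rev :=
    fun _ => rfl
  simp only [h2, WW_rev M D k hM]
  refine row_sum M D hD hDM (α / M) _ (by positivity) ((div_le_one hM').2 hα1) ?_ k _
  intro t
  rw [← Finset.mul_sum]
  have h3 := block3 q D hq hqD b hb (α / M) t hβ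
  calc _ ≤ 3 * (D:ℝ) * (8 * (1 + Real.log q) * (D / q)) := by gcongr
    _ = _ := by ring

lemma core (M D k q N : ℕ) (α : ℚ) (b : ℤ) (hD : 0 < D) (hDM : D * D ≤ M) (hα0 : 1 ≤ α)
    (hα1 : α ≤ M) (hN : (N : ℚ) = α * (M : ℚ) ^ k) (hN0 : 0 < N)
    (hq : 0 < q) (hqD : q ≤ D) (hb : Int.gcd b q = 1)
    (hβ : |(α : ℝ) / M - b / q| ≤ 1 / (q * D)) :
    opNorm (indicatorMatrix N (cantorCdil M k (Finset.range D) α) * dftMatrix N *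
          indicatorMatrix N (cantorCdil M k (Finset.range D) α)) ≤
      (Real.sqrt N)⁻¹ * (Real.exp (2 * Real.pi) * (Real.exp (2 * Real.pi) *
      (Real.sqrt ((24 * (1 + Real.log q) * (D ^ 2 / q)) ^ k)))) := by
  have hM : 0 < M := by nlinarith
  have hDM' : D ≤ M := by nlinarith
  have hM' : (0:ℝ) < M := by exact_mod_cast hM
  have hN' : (0:ℝ) < N := by exact_mod_cast hN0
  have hNr : (N : ℝ) = α * (M : ℝ) ^ k := by exact_mod_cast hN
  have hαr : (1:ℝ) ≤ α := by exact_mod_cast hα0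
  have hαr1 : (α:ℝ) ≤ M := by exact_mod_cast hα1
  set cc : (Fin k → Fin D) → ℕ := fun a => (⌈α * (WW M D k a : ℚ)⌉).toNat with hcc
  have hceil : ∀ a, ((cc a : ℕ) : ℤ) = ⌈α * (WW M D k a : ℚ)⌉ := by
    intro a
    apply Int.toNat_of_nonneg
    apply Int.ceil_nonneg
    positivity
  have hge : ∀ a, (α:ℝ) * WW M D k a ≤ cc a := by
    intro a
    have h1 := Int.le_ceil (α * (WW M D k a : ℚ))
    rw [← hceil] at h1
    exact_mod_cast h1
  have hlt : ∀ a, (cc a : ℝ) < (α:ℝ) * WW M D k a + 1 := by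
    intro a
    have h1 := Int.ceil_lt_add_one (α * (WW M D k a : ℚ))
    rw [← hceil] at h1
    exact_mod_cast h1
  have hWle : ∀ a, (α:ℝ) * WW M D k a + 1 ≤ N := by
    intro a
    have h1 : (WW M D k a : ℝ) + 1 ≤ (M:ℝ) ^ k := by exact_mod_cast WW_lt M D k hDM' a
    rw [hNr]
    nlinarith
  have hccN : ∀ a, cc a < N := by
    intro a
    have := (hlt a).trans_le (hWle a)
    exact_mod_cast this
  have hinj : Function.Injective cc := by
    intro a a' h
    apply WW_inj M D k hDM'
    have h1 := hge a
    have h2 := hlt a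
    have h3 := hge a'
    have h4 := hlt a'
    rw [h] at h1 h2
    rcases lt_trichotomy (WW M D k a) (WW M D k a') with h5 | h5 | h5
    · have h6 : (WW M D k a : ℝ) + 1 ≤ WW M D k a' := by exact_mod_cast h5
      nlinarith
    · exact h5
    · have h6 : (WW M D k a' : ℝ) + 1 ≤ WW M D k a := by exact_mod_cast h5
      nlinarith
  refine opNorm_le_of_BL N _ (fun a => ⟨cc a, hccN a⟩) ?_ ?_ _ _ (by positivity) ?_
  · intro a a' h
    exact hinj (Fin.mk.inj_iff.1 h)
  · intro j
    unfold cantorCdil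
    simp only [Finset.mem_image, Finset.bind_def, Finset.pure_def, Finset.mem_sup,
      Finset.mem_singleton, mem_cantorC]
    constructor
    · rintro ⟨n, ⟨m, ⟨a, rfl⟩, rfl⟩, h⟩
      exact ⟨a, Fin.ext h⟩
    · rintro ⟨a, rfl⟩
      exact ⟨_, ⟨_, ⟨a, rfl⟩, rfl⟩, rfl⟩
  · have h0 := core_BL M D k q α b hD hDM (by linarith) hαr1 hq hqD hb hβ
    have h1 := BL_twist _ _ (Real.sqrt_nonneg _) h0 (fun a => cc a - α * WW M D k a)
      (fun c => cc c / N) (by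
        intro a
        rw [abs_le]; constructor <;> linarith [hge a, hlt a]) (by
        intro c
        rw [abs_of_nonneg (by positivity)]
        apply (div_le_one hN').2
        exact_mod_cast (hccN c).le)
    have h2 := BL_twist _ _ (by positivity) h1 (fun a => α * WW M D k a / N)
      (fun c => cc c - α * WW M D k c) (by
        intro c
        rw [abs_of_nonneg (by positivity)]
        apply (div_le_one hN').2
        linarith [hWle c]) (by
        intro a
        rw [abs_le]; constructor <;> linarith [hge a, hlt a])
    have h3 := BL_smul _ _ (Real.sqrt N)⁻¹ (by positivity) h2
    convert h3 using 1
    funext a c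
    unfold dftMatrix
    rw [Matrix.of_apply, ← ec_add, ← ec_add]
    congr 2
    have hα : (α:ℝ) ≠ 0 := by positivity
    rw [hNr]
    field_simp
    ring
/-- Fractal uncertainty principle for dilated discrete Cantor sets. -/
theorem stmt1 (ε : ℝ) (hε : 0 < ε) :
    ∃ M₀ k₀ : ℕ, ∀ (M D : ℕ) (δ : ℝ) (α : ℚ) (k N : ℕ) (b : ℤ) (q : ℕ),
      M₀ ≤ M → 0 < δ → δ ≤ 1 / 2 → (D : ℝ) = (M : ℝ) ^ δ →
      1 ≤ α → α < (M : ℚ) → k₀ ≤ k → 0 < N → (N : ℚ) = α * (M : ℚ) ^ k → M ∣ N →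
      0 < q → Int.gcd b q = 1 → (q : ℝ) ≤ (M : ℝ) ^ δ →
      |(α : ℝ) / (M : ℝ) - (b : ℝ) / (q : ℝ)| < 1 / ((q : ℝ) * (M : ℝ) ^ δ) →
      opNorm (indicatorMatrix N (cantorCdil M k (Finset.range D) α) * dftMatrix N *
          indicatorMatrix N (cantorCdil M k (Finset.range D) α)) ≤
        (N : ℝ) ^ (-(1 / 2 - δ + (Real.log q / Real.log M) / 2) + ε) := by
  have hasym : ∀ᶠ M : ℕ in Filter.atTop,
      24 * (1 + Real.log M) * (Real.exp (2 * Real.pi) * Real.exp (2 * Real.pi)) ^ 2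
        ≤ (M : ℝ) ^ (2 * ε) := by
    set C := 24 * (Real.exp (2 * Real.pi) * Real.exp (2 * Real.pi)) ^ 2 with hC
    have hCp : 0 < C := by positivity
    have h1 : (fun x : ℝ => 1 + Real.log x) =o[Filter.atTop] fun x : ℝ => x ^ (2 * ε) := by
      refine Asymptotics.IsLittleO.add ?_ (isLittleO_log_rpow_atTop (by positivity))
      refine (Asymptotics.isLittleO_const_left.2 (Or.inr ?_))
      exact tendsto_norm_atTop_atTop.comp (tendsto_rpow_atTop (by positivity))
    have h2 := (h1.bound (inv_pos.2 hCp))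
    have h3 := tendsto_natCast_atTop_atTop (R := ℝ) |>.eventually h2
    filter_upwards [h3] with M hM
    rw [Real.norm_eq_abs, Real.norm_eq_abs, abs_of_nonneg (a := (M:ℝ) ^ (2 * ε)) (by positivity)] at hM
    have h4 := (le_abs_self _).trans hM
    rw [inv_mul_eq_div, le_div_iff₀ hCp] at h4
    linarith
  obtain ⟨M₀, hM₀⟩ := Filter.eventually_atTop.1 hasym
  refine ⟨max M₀ 2, 1, ?_⟩
  intro M D δ α k N b q hM hδ0 hδ1 hDδ hα0 hα1 hk hN0 hN _ hq hb hqδ hβ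
  have hM2 : 2 ≤ M := (le_max_right _ _).trans hM
  have hM1 := hM₀ M ((le_max_left _ _).trans hM)
  have hMr : (2:ℝ) ≤ M := by exact_mod_cast hM2
  have hMp : (0:ℝ) < M := by linarith
  rw [← hDδ] at hqδ hβ
  have hqD : q ≤ D := by exact_mod_cast hqδ
  have hD : 0 < D := by omega
  have hq' : (0:ℝ) < q := by exact_mod_cast hq
  have hD' : (0:ℝ) < D := by exact_mod_cast hD
  have hDM : D * D ≤ M := by
    have : (D:ℝ) * D ≤ M := by
      rw [hDδ, ← Real.rpow_add hMp]
      calc (M:ℝ) ^ (δ + δ) ≤ (M:ℝ) ^ (1:ℝ) :=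
            Real.rpow_le_rpow_of_exponent_le (by linarith) (by linarith)
        _ = M := Real.rpow_one _
    exact_mod_cast this
  have hDM' : D ≤ M := by nlinarith
  have hN' : (0:ℝ) < N := by exact_mod_cast hN0
  have hNr : (N : ℝ) = α * (M : ℝ) ^ k := by exact_mod_cast hN
  have hαr : (1:ℝ) ≤ α := by exact_mod_cast hα0
  have hNM : (M:ℝ) ^ k ≤ N := by
    rw [hNr]
    exact le_mul_of_one_le_left (by positivity) hαr
  refine (core M D k q N α b hD hDM hα0 hα1.le hN hN0 hq hqD hb hβ.le).trans ?_
  set γ := Real.log q / Real.log M with hγ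
  have hlogM : 0 < Real.log M := Real.log_pos (by linarith)
  have hqγ : (q:ℝ) = (M:ℝ) ^ γ := by
    rw [Real.rpow_def_of_pos hMp, hγ, mul_div_cancel₀ _ hlogM.ne', Real.exp_log hq']
  have hγδ : γ ≤ δ := by
    have : (M:ℝ) ^ γ ≤ (M:ℝ) ^ δ := by rw [← hqγ, ← hDδ]; exact hqδ
    exact (Real.rpow_le_rpow_left_iff (by linarith)).1 this
  have hqM : Real.log q ≤ Real.log M :=
    Real.log_le_log hq' (by exact_mod_cast hqD.trans hDM')
  have hlq : 0 ≤ Real.log q := Real.log_natCast_nonneg q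
  set E := Real.exp (2 * Real.pi) * Real.exp (2 * Real.pi) with hE
  have hE1 : 1 ≤ E := by
    have : 1 ≤ Real.exp (2 * Real.pi) := Real.one_le_exp (by have := Real.pi_pos; positivity)
    rw [hE]; nlinarith
  -- exponent split
  have e1 : -(1 / 2 - δ + γ / 2) + ε = -(1/2 : ℝ) + (δ - γ / 2 + ε) := by ring
  rw [e1, Real.rpow_add hN', Real.rpow_neg hN'.le, ← Real.sqrt_eq_rpow, ← mul_assoc (Real.exp _)]
  refine mul_le_mul_of_nonneg_left ?_ (by positivity)
  have hs : 0 ≤ δ - γ / 2 + ε := by linarith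
  refine le_trans ?_ (Real.rpow_le_rpow (by positivity) hNM hs)
  rw [← hE, ← Real.sqrt_sq (by linarith : 0 ≤ E), ← Real.sqrt_mul (by positivity)]
  apply Real.sqrt_le_iff.2
  refine ⟨by positivity, ?_⟩
  have e2 : (((M:ℝ) ^ k) ^ (δ - γ / 2 + ε)) ^ 2 = ((M:ℝ) ^ (2 * ε) * (D ^ 2 / q)) ^ k := by
    have : (M:ℝ) ^ (2 * ε) * (D ^ 2 / q) = ((M:ℝ) ^ (δ - γ / 2 + ε)) ^ 2 := by
      rw [hDδ, hqγ, ← Real.rpow_natCast, ← Real.rpow_natCast, ← Real.rpow_mul hMp.le,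
        ← Real.rpow_mul hMp.le, ← Real.rpow_sub hMp, ← Real.rpow_add hMp]
      congr 1
      push_cast
      ring
    rw [this, ← Real.rpow_natCast_mul hMp.le, ← pow_mul, ← Real.rpow_mul_natCast hMp.le,
      ← Real.rpow_mul_natCast hMp.le]
    congr 1
    push_cast
    ring
  rw [e2]
  have hE2 : E ^ 2 ≤ (E ^ 2) ^ k := le_self_pow₀ (one_le_pow₀ hE1) (by omega)
  calc E ^ 2 * (24 * (1 + Real.log q) * (D ^ 2 / q)) ^ k
      ≤ (E ^ 2) ^ k * (24 * (1 + Real.log q) * (D ^ 2 / q)) ^ k := by gcongr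
    _ = (24 * (1 + Real.log q) * E ^ 2 * (D ^ 2 / q)) ^ k := by rw [← mul_pow]; ring
    _ ≤ (24 * (1 + Real.log M) * E ^ 2 * (D ^ 2 / q)) ^ k := by gcongr
    _ ≤ _ := by gcongr

end
end

section
/- Let M, k ∈ ℕ with M ≥ 2, k ≥ 1, let A ⊆ {0,…,M−1}, and let f : ℤ → ℂ be supported in A. With u_k ∈ ℂ^{M^k} defined as the iterated cyclic convolution u_k = f * f_M * f_{M²} * ⋯ * f_{M^{k−1}} (and u_1 = f), one has for every j ∈ {0,…,M^k−1}: (F_{M^k} u_k)(j) = Π_{r=1}^{k} G_f(j/M^r). -/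
open scoped Classical

noncomputable section

/-- The 1-periodic function `G_f(x) = M^{-1/2} Σ_{l ∈ ℤ} f(l) e^{-2πi l x}`. -/
def Gf (M : ℕ) (f : ℤ → ℂ) (x : ℝ) : ℂ :=
  ((Real.sqrt M)⁻¹ : ℝ) * ∑' l : ℤ, f l * ec ((l : ℝ) * x)

/-- Cyclic convolution on `ℂ^N`: `(f*h)(n) = Σ_{n₁+n₂ = n mod N} f(n₁) h(n₂)`. -/
def cconv {N : ℕ} (f h : Fin N → ℂ) : Fin N → ℂ := fun n => ∑ m : Fin N, f m * h (n - m)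

/-- The function `f_{M^j} ∈ ℂ^{M^k}` (here `Nn = M^k`, `p = M^j`):
`f_{M^j}(n) = f(n/M^j)` if `M^j ∣ n` and `n/M^j ∈ A`, and `0` otherwise. -/
def dilate (Nn p : ℕ) (A : Finset ℕ) (f : ℤ → ℂ) : Fin Nn → ℂ := fun n =>
  if p ∣ (n : ℕ) ∧ (n : ℕ) / p ∈ A then f (((n : ℕ) / p : ℕ) : ℤ) else 0

/-- The iterated cyclic convolution `u_k = f * f_M * f_{M²} * ⋯ * f_{M^{k-1}} ∈ ℂ^{M^k}`
(for `f` supported in `A ⊆ {0,…,M-1}`, the factor `f_{M^0}` equals `f`). -/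
def uFun (M k : ℕ) (A : Finset ℕ) (f : ℤ → ℂ) : Fin (M ^ k) → ℂ :=
  (List.range k).foldr (fun j acc => cconv (dilate (M ^ k) (M ^ j) A f) acc)
    (fun n => if (n : ℕ) = 0 then 1 else 0)

lemma ec_nat (n : ℕ) : ec n = 1 := by
  unfold ec
  rw [Complex.exp_eq_one_iff]
  refine ⟨-(n : ℤ), ?_⟩
  push_cast
  ring

lemma ec_fin_add {N : ℕ} [NeZero N] (j : ℕ) (a b : Fin N) :
    ec ((j : ℝ) * ((a + b : Fin N) : ℕ) / (N : ℝ)) =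
      ec ((j : ℝ) * (a : ℕ) / (N : ℝ)) * ec ((j : ℝ) * (b : ℕ) / (N : ℝ)) := by
  have hN : (N : ℝ) ≠ 0 := Nat.cast_ne_zero.mpr (NeZero.ne N)
  rw [← ec_add, Fin.val_add]
  have h := Nat.mod_add_div ((a : ℕ) + b) N
  have h2 : (((a : ℕ) + (b : ℕ) : ℕ) : ℝ) =
      ((((a : ℕ) + b) % N : ℕ) : ℝ) + N * ((((a : ℕ) + b) / N : ℕ) : ℝ) := by
    exact_mod_cast h.symm
  have h3 : (j : ℝ) * (a : ℕ) / (N : ℝ) + (j : ℝ) * (b : ℕ) / (N : ℝ)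
      = (j : ℝ) * ((((a : ℕ) + b) % N : ℕ) : ℝ) / N + ((j * (((a : ℕ) + b) / N) : ℕ) : ℝ) := by
    rw [← add_div, ← mul_add, ← Nat.cast_add, h2, Nat.cast_mul]
    field_simp
  rw [h3, ec_add, ec_nat, mul_one]

lemma sum_cconv {N : ℕ} [NeZero N] (j : ℕ) (f h : Fin N → ℂ) :
    ∑ n : Fin N, ec ((j : ℝ) * (n : ℕ) / (N : ℝ)) * cconv f h n =
      (∑ n : Fin N, ec ((j : ℝ) * (n : ℕ) / (N : ℝ)) * f n) *
      (∑ n : Fin N, ec ((j : ℝ) * (n : ℕ) / (N : ℝ)) * h n) := by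
  unfold cconv
  rw [Finset.sum_mul_sum]
  simp_rw [Finset.mul_sum]
  rw [Finset.sum_comm]
  refine Finset.sum_congr rfl fun m _ => ?_
  rw [← Equiv.sum_comp (Equiv.addRight m)]
  refine Finset.sum_congr rfl fun n _ => ?_
  rw [Equiv.coe_addRight, ec_fin_add, add_sub_cancel_right]
  ring

lemma tsum_supp (A : Finset ℕ) (f : ℤ → ℂ) (hf : ∀ l : ℤ, f l ≠ 0 → ∃ a ∈ A, l = (a : ℤ))
    (x : ℝ) : ∑' l : ℤ, f l * ec ((l : ℝ) * x) = ∑ a ∈ A, f a * ec ((a : ℝ) * x) := by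
  rw [tsum_eq_sum (s := A.map Nat.castEmbedding)]
  · rw [Finset.sum_map]
    simp
  · intro b hb
    by_cases h : f b = 0
    · simp [h]
    · obtain ⟨a, ha, rfl⟩ := hf b h
      exact absurd (Finset.mem_map.mpr ⟨a, ha, rfl⟩) hb

lemma sum_dilate (M k i : ℕ) (hM : 2 ≤ M) (hi : i < k) (A : Finset ℕ) (hA : A ⊆ Finset.range M)
    (f : ℤ → ℂ) (j : ℕ) :
    ∑ n : Fin (M ^ k), ec ((j : ℝ) * (n : ℕ) / ((M ^ k : ℕ) : ℝ)) * dilate (M ^ k) (M ^ i) A f n =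
      ∑ a ∈ A, f a * ec ((a : ℝ) * ((j : ℝ) / (M : ℝ) ^ (k - i))) := by
  have hM0 : 0 < M := by omega
  have hp : 0 < M ^ i := pow_pos hM0 i
  have hMr : (M : ℝ) ≠ 0 := Nat.cast_ne_zero.mpr hM0.ne'
  have hlt : ∀ a ∈ A, a * M ^ i < M ^ k := by
    intro a ha
    have h1 : a < M := Finset.mem_range.mp (hA ha)
    calc a * M ^ i < M * M ^ i := Nat.mul_lt_mul_of_pos_right h1 hp
      _ = M ^ (i + 1) := by ring
      _ ≤ M ^ k := Nat.pow_le_pow_right hM0 hi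
  unfold dilate
  simp_rw [mul_ite, mul_zero]
  rw [← Finset.sum_filter]
  symm
  refine Finset.sum_bij (fun a ha => (⟨a * M ^ i, hlt a ha⟩ : Fin (M ^ k))) ?_ ?_ ?_ ?_
  · intro a ha
    simp [Nat.mul_div_cancel _ hp, ha]
  · intro a ha b hb hab
    exact Nat.eq_of_mul_eq_mul_right hp (Fin.mk.inj_iff.mp hab)
  · intro b hb
    simp only [Finset.mem_filter, Finset.mem_univ, true_and] at hb
    exact ⟨_, hb.2, Fin.ext (Nat.div_mul_cancel hb.1)⟩
  · intro a ha
    simp only [Nat.mul_div_cancel _ hp]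
    rw [mul_comm]
    congr 2
    have : (M : ℝ) ^ k = M ^ (k - i) * M ^ i := by rw [← pow_add]; congr 1; omega
    push_cast
    rw [this]
    field_simp

lemma sum_foldr {N : ℕ} [NeZero N] (j : ℕ) (g : ℕ → Fin N → ℂ) (L : List ℕ) :
    ∑ n : Fin N, ec ((j : ℝ) * (n : ℕ) / (N : ℝ)) *
      L.foldr (fun i acc => cconv (g i) acc) (fun n => if (n : ℕ) = 0 then 1 else 0) n =
    (L.map fun i => ∑ n : Fin N, ec ((j : ℝ) * (n : ℕ) / (N : ℝ)) * g i n).prod := by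
  induction L with
  | nil =>
    simp only [List.foldr_nil, List.map_nil, List.prod_nil]
    rw [Finset.sum_eq_single (0 : Fin N)]
    · simpa using ec_nat 0
    · intro b _ hb
      have : (b : ℕ) ≠ 0 := fun h => hb (Fin.ext (by simpa using h))
      simp [this]
    · simp
  | cons a L ih =>
    rw [List.foldr_cons, sum_cconv, ih, List.map_cons, List.prod_cons]

/-- `(F_{M^k} u_k)(j) = Π_{r=1}^k G_f(j/M^r)`. -/
theorem stmt4 (M k : ℕ) (hM : 2 ≤ M) (hk : 1 ≤ k) (A : Finset ℕ) (hA : A ⊆ Finset.range M)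
    (f : ℤ → ℂ) (hf : ∀ l : ℤ, f l ≠ 0 → ∃ a ∈ A, l = (a : ℤ)) (j : Fin (M ^ k)) :
    (dftMatrix (M ^ k)).mulVec (uFun M k A f) j =
      ∏ r ∈ Finset.Icc 1 k, Gf M f (((j : ℕ) : ℝ) / (M : ℝ) ^ r) := by
  have hM0 : 0 < M := by omega
  have : NeZero (M ^ k) := ⟨(pow_pos hM0 k).ne'⟩
  have hS := sum_foldr (N := M ^ k) j (fun i => dilate (M ^ k) (M ^ i) A f) (List.range k)
  have h1 : (dftMatrix (M ^ k)).mulVec (uFun M k A f) j =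
      ((Real.sqrt ((M ^ k : ℕ) : ℝ))⁻¹ : ℝ) *
        ∑ n : Fin (M ^ k), ec (((j : ℕ) : ℝ) * (n : ℕ) / ((M ^ k : ℕ) : ℝ)) * uFun M k A f n := by
    simp only [Matrix.mulVec, dotProduct, dftMatrix, Matrix.of_apply, Finset.mul_sum, mul_assoc]
  have h2 : (Real.sqrt ((M ^ k : ℕ) : ℝ))⁻¹ = ((Real.sqrt M)⁻¹) ^ k := by
    rw [inv_pow]
    congr 1
    rw [Real.sqrt_eq_iff_mul_self_eq (by positivity) (by positivity), ← mul_pow,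
      Real.mul_self_sqrt (by positivity)]
    push_cast
    rfl
  rw [h1]
  unfold uFun
  rw [hS, h2]
  have h3 : ∀ g : ℕ → ℂ, ((List.range k).map g).prod = ∏ i ∈ Finset.range k, g i := fun g => rfl
  rw [h3]
  unfold Gf
  rw [Finset.prod_mul_distrib, Finset.prod_const, Nat.card_Icc, Nat.add_sub_cancel]
  push_cast
  congr 1
  refine Finset.prod_bij (fun i _ => k - i) ?_ ?_ ?_ ?_
  · intro i hi
    simp only [Finset.mem_range, Finset.mem_Icc] at *
    omega
  · intro a ha b hb hab
    simp only [Finset.mem_range] at *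
    omega
  · intro b hb
    simp only [Finset.mem_Icc] at hb
    exact ⟨k - b, Finset.mem_range.mpr (by omega), by omega⟩
  · intro i hi
    rw [tsum_supp A f hf, ← sum_dilate M k i hM (Finset.mem_range.mp hi) A hA f j]
    push_cast
    rfl

end
end
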